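/- Let A be a finite-dimensional regular weak Hopf algebra over an algebraically closed field k of characteristic 0 which is unimodular, i.e., possesses a non-degenerate two-sided integral ℓ₀ (ℓ₀ is simultaneously a left and a right integral and is non-degenerate). Then the map z ↦ ℓ₀z is a k-linear bijection from A_t ∩ Z(A) onto the space {ℓ ∈ A : ℓ is a left integral and S(ℓ) = ℓ} of S-invariant left integrals; in particular this space is linearly isomorphic to A_t ∩ Z(A). Consequently, if in addition A is connected, then A contains a non-degenerate S-invariant left integral, unique up to a scalar multiple. -/

import Mathlib

open TensorProduct

noncomputable section

variable (k : Type*) [Field k] (A : Type*) [Ring A] [Algebra k A]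

/-- A weak Hopf algebra structure on the `k`-algebra `A` (Böhm–Szlachányi). -/
structure WeakHopf : Type _ where
  comul : A →ₗ[k] A ⊗[k] A
  counit : A →ₗ[k] k
  antipode : A →ₗ[k] A
  antipode_bijective : Function.Bijective antipode
  comul_coassoc :
      (TensorProduct.map comul LinearMap.id).comp comul
        = (TensorProduct.assoc k A A A).symm.toLinearMap.comp
            ((TensorProduct.map LinearMap.id comul).comp comul)
  counit_comul_left : ∀ a : A,
      TensorProduct.lid k A (TensorProduct.map counit LinearMap.id (comul a)) = a
  counit_comul_right : ∀ a : A,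
      TensorProduct.rid k A (TensorProduct.map LinearMap.id counit (comul a)) = a
  comul_mul : ∀ g h : A, comul (g * h) = comul g * comul h
  comul_one_left :
      TensorProduct.map comul LinearMap.id (comul 1)
        = (comul 1 ⊗ₜ[k] (1 : A))
            * (TensorProduct.assoc k A A A).symm ((1 : A) ⊗ₜ[k] comul 1)
  comul_one_right :
      TensorProduct.map comul LinearMap.id (comul 1)
        = (TensorProduct.assoc k A A A).symm ((1 : A) ⊗ₜ[k] comul 1)
            * (comul 1 ⊗ₜ[k] (1 : A))
  counit_mul_left : ∀ f g h : A,
      counit (f * g * h)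
        = TensorProduct.lift ((LinearMap.mul k k).compl₁₂
            (counit ∘ₗ LinearMap.mulLeft k f) (counit ∘ₗ LinearMap.mulRight k h)) (comul g)
  counit_mul_right : ∀ f g h : A,
      counit (f * g * h)
        = TensorProduct.lift ((LinearMap.mul k k).compl₁₂
            (counit ∘ₗ LinearMap.mulRight k h) (counit ∘ₗ LinearMap.mulLeft k f)) (comul g)
  antipode_left : ∀ h : A,
      LinearMap.mul' k A (TensorProduct.map LinearMap.id antipode (comul h))
        = TensorProduct.lid k A
            (TensorProduct.map counit LinearMap.id (comul 1 * (h ⊗ₜ[k] (1 : A))))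
  antipode_right : ∀ h : A,
      LinearMap.mul' k A (TensorProduct.map antipode LinearMap.id (comul h))
        = TensorProduct.rid k A
            (TensorProduct.map LinearMap.id counit (((1 : A) ⊗ₜ[k] h) * comul 1))
  antipode_mid : ∀ h : A,
      LinearMap.mul' k A (TensorProduct.map (LinearMap.mul' k A) LinearMap.id
        (TensorProduct.map (TensorProduct.map antipode LinearMap.id) antipode
          (TensorProduct.map comul LinearMap.id (comul h))))
        = antipode h

namespace WeakHopf

variable {k A}
variable (W : WeakHopf k A)

/-- The target counital map `ε_t(h) = ε(1₍₁₎h)1₍₂₎ = (ε ⊗ id)(Δ(1)(h ⊗ 1))`. -/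
def εt : A →ₗ[k] A :=
  (TensorProduct.lid k A).toLinearMap
    ∘ₗ TensorProduct.map W.counit LinearMap.id
    ∘ₗ LinearMap.mulLeft k (W.comul 1)
    ∘ₗ (TensorProduct.mk k A A).flip 1

/-- The source counital map `ε_s(h) = 1₍₁₎ε(h1₍₂₎) = (id ⊗ ε)((1 ⊗ h)Δ(1))`. -/
def εs : A →ₗ[k] A :=
  (TensorProduct.rid k A).toLinearMap
    ∘ₗ TensorProduct.map LinearMap.id W.counit
    ∘ₗ LinearMap.mulRight k (W.comul 1)
    ∘ₗ TensorProduct.mk k A A 1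

/-- The target base `A_t = ε_t(A)`. -/
def targetBase : Submodule k A := LinearMap.range W.εt

/-- The source base `A_s = ε_s(A)`. -/
def sourceBase : Submodule k A := LinearMap.range W.εs

/-- The minimal weak Hopf subalgebra, generated by `A_s` and `A_t`. -/
def minimalSub : Subalgebra k A :=
  Algebra.adjoin k ((W.targetBase : Set A) ∪ (W.sourceBase : Set A))

/-- `A` is regular if `S²` is the identity on `A_min`. -/
def Regular : Prop := ∀ x ∈ W.minimalSub, W.antipode (W.antipode x) = x

/-- `A` is connected if `Z(A) ∩ A_t = k·1`. -/
def Connected : Prop :=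
  ∀ a : A, (a ∈ Subalgebra.center k A ∧ a ∈ W.targetBase) ↔ ∃ c : k, a = c • (1 : A)

/-- `A` is coconnected if `A_s ∩ A_t = k·1`. -/
def Coconnected : Prop :=
  ∀ a : A, (a ∈ W.sourceBase ∧ a ∈ W.targetBase) ↔ ∃ c : k, a = c • (1 : A)

def Biconnected : Prop := W.Connected ∧ W.Coconnected

/-- A left integral: `hℓ = ε_t(h)ℓ` for all `h`. -/
def IsLeftIntegral (ℓ : A) : Prop := ∀ h : A, h * ℓ = W.εt h * ℓ

/-- A right integral: `rh = rε_s(h)` for all `h`. -/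
def IsRightIntegral (r : A) : Prop := ∀ h : A, r * h = r * W.εs h

/-- The Sweedler arrow `φ ⇀ a = a₍₁₎⟨φ, a₍₂₎⟩`. -/
def harpoon (φ : Module.Dual k A) : A →ₗ[k] A :=
  (TensorProduct.rid k A).toLinearMap
    ∘ₗ TensorProduct.map LinearMap.id φ
    ∘ₗ W.comul

/-- An integral `ℓ` is non-degenerate if `φ ↦ φ ⇀ ℓ` is injective. -/
def IsNondegenerateIntegral (ℓ : A) : Prop :=
  Function.Injective fun φ : Module.Dual k A => W.harpoon φ ℓ

/-- The convolution product on the dual: `(φψ)(h) = φ(h₍₁₎)ψ(h₍₂₎)`. -/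
def conv (φ ψ : Module.Dual k A) : Module.Dual k A :=
  TensorProduct.lift ((LinearMap.mul k k).compl₁₂ φ ψ) ∘ₗ W.comul

/-- The canonical left integral `λ ∈ A*`, `λ(h) = Tr(L_h ∘ S²)`. -/
def canonicalLambda : Module.Dual k A :=
  (LinearMap.trace k A)
    ∘ₗ (LinearMap.llcomp k A A A).flip (W.antipode ∘ₗ W.antipode)
    ∘ₗ (LinearMap.mul k A)

/-- The target counital map of the dual weak Hopf algebra: `ε̂_t(φ) = φ ∘ ε_t`. -/
def dualCounitalTarget (φ : Module.Dual k A) : Module.Dual k A := φ ∘ₗ W.εt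

/-- The source counital map of the dual weak Hopf algebra: `ε̂_s(φ) = φ ∘ ε_s`. -/
def dualCounitalSource (φ : Module.Dual k A) : Module.Dual k A := φ ∘ₗ W.εs

/-- The map `a ↦ e(a₍₁₎)a₍₂₎`; left convolution by `e` on `A*` is precomposition
with this map. -/
def coactL (e : Module.Dual k A) : A →ₗ[k] A :=
  (TensorProduct.lid k A).toLinearMap ∘ₗ TensorProduct.map e LinearMap.id ∘ₗ W.comul

/-- A group-like element: invertible with `Δ(g) = (g⊗g)Δ(1) = Δ(1)(g⊗g)`. -/
def IsGroupLike (g : A) : Prop :=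
  IsUnit g ∧ W.comul g = (g ⊗ₜ[k] g) * W.comul 1 ∧ W.comul g = W.comul 1 * (g ⊗ₜ[k] g)

/-- A pivotal element: a group-like `G` with `S²(h) = GhG⁻¹`, i.e. `S²(h)G = Gh`. -/
def IsPivotal (g : A) : Prop :=
  W.IsGroupLike g ∧ ∀ h : A, W.antipode (W.antipode h) * g = g * h

/-- A trivial group-like element: `g = yS(y)⁻¹` for invertible `y ∈ A_s`
(note `S(y)⁻¹ = S(y⁻¹)`). -/
def IsTrivialGroupLike (g : A) : Prop :=
  ∃ y yi : A, y ∈ W.sourceBase ∧ y * yi = 1 ∧ yi * y = 1 ∧ g = y * W.antipode yi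

/-- The character of the trivial `A`-module `A_t`, `h · z = ε_t(hz)`. -/
def trivialChar : A → k := fun h =>
  LinearMap.trace k W.targetBase
    ((W.εt ∘ₗ LinearMap.mulLeft k h).restrict
      (p := W.targetBase) (q := W.targetBase) (fun x _ => ⟨h * x, rfl⟩))

end WeakHopf

/-- The Wedderburn data of a finite-dimensional semisimple algebra: a complete family
of primitive central idempotents `z j`, together with the matrix sizes `d j`
(so that `(d j)² = dim_k (z j · A)`, i.e. the block `z j · A ≅ M_{d j}(k)`). -/
structure WedderburnData (n : ℕ) : Type _ where
  z : Fin n → A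
  d : Fin n → ℕ
  central : ∀ j, z j ∈ Subalgebra.center k A
  idem : ∀ j, z j * z j = z j
  nonzero : ∀ j, z j ≠ 0
  primitive : ∀ (j : Fin n) (q r : A), q ∈ Subalgebra.center k A →
      r ∈ Subalgebra.center k A → q * q = q → r * r = r → q * r = 0 →
      q + r = z j → q = 0 ∨ r = 0
  orthogonal : ∀ i j, i ≠ j → z i * z j = 0
  total : ∑ j, z j = 1
  d_sq : ∀ j, (d j) ^ 2 = Module.finrank k (LinearMap.range (LinearMap.mulLeft k (z j)))

/-- The irreducible characters of a finite-dimensional semisimple algebra: the character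
of the simple module corresponding to the block `z j · A` is
`χ_j(h) = Tr(L_{z_j h} | A) / d j`. -/
def WedderburnData.char {k A : Type*} [Field k] [Ring A] [Algebra k A] {n : ℕ}
    (D : WedderburnData k A n) : Fin n → Module.Dual k A := fun j =>
  (D.d j : k)⁻¹ •
    ((LinearMap.trace k A) ∘ₗ (LinearMap.mul k A) ∘ₗ LinearMap.mulLeft k (D.z j))

/-- Frobenius–Perron data for a semisimple weak Hopf algebra over `ℂ`: the non-negative
integer structure constants of the products of the irreducible characters under
convolution, and the Frobenius–Perron dimensions `f j = FPdim(V_j)` of the simple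
modules, i.e. the unique strictly positive solution of `f i · f j = Σ_m N i j m · f m`. -/
structure FPData {A : Type*} [Ring A] [Algebra ℂ A] (W : WeakHopf ℂ A) {n : ℕ}
    (D : WedderburnData ℂ A n) : Type _ where
  N : Fin n → Fin n → Fin n → ℕ
  conv_char : ∀ i j, W.conv (D.char i) (D.char j) = ∑ m, (N i j m : ℂ) • D.char m
  f : Fin n → ℝ
  f_pos : ∀ j, 0 < f j
  f_mul : ∀ i j, f i * f j = ∑ m, (N i j m : ℝ) * f m

/-- A Frobenius–Perron element of `A_s`: a non-zero `w ∈ Z(A_s)` with strictly positive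
eigenvalues such that `χ_{V_j} ⇀ w = FPdim(V_j) • w` for all simple modules `V_j`
(hence for all finite-dimensional modules). -/
def WeakHopf.IsFPElement {A : Type*} [Ring A] [Algebra ℂ A] (W : WeakHopf ℂ A) {n : ℕ}
    (D : WedderburnData ℂ A n) (F : FPData W D) (w : A) : Prop :=
  w ≠ 0 ∧ w ∈ W.sourceBase ∧ (∀ y ∈ W.sourceBase, w * y = y * w) ∧
  (∀ c ∈ spectrum ℂ w, ∃ r : ℝ, 0 < r ∧ c = (r : ℂ)) ∧
  ∀ j, W.harpoon (D.char j) w = ((F.f j : ℂ)) • w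

/-- A duality pairing realizing the weak Hopf algebra `B` as the dual `A*` of the weak
Hopf algebra `A` (so that `B` carries the dual weak Hopf algebra structure:
`⟨φψ, h⟩ = ⟨φ, h₍₁₎⟩⟨ψ, h₍₂₎⟩`, `1_B = ε_A`, `⟨Δφ, g ⊗ h⟩ = ⟨φ, gh⟩`,
`ε_B(φ) = ⟨φ, 1⟩`, `⟨S_B(φ), h⟩ = ⟨φ, S_A(h)⟩`). -/
structure DualPair {k A B : Type*} [Field k] [Ring A] [Algebra k A] [Ring B] [Algebra k B]
    (W : WeakHopf k A) (W' : WeakHopf k B) : Type _ where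
  pair : B →ₗ[k] Module.Dual k A
  bij : Function.Bijective pair
  mul_compat : ∀ φ ψ : B, pair (φ * ψ) = W.conv (pair φ) (pair ψ)
  one_compat : pair 1 = W.counit
  comul_compat : ∀ (φ : B) (g h : A),
      TensorProduct.lift ((LinearMap.mul k k).compl₁₂ (pair.flip g) (pair.flip h))
          (W'.comul φ) = pair φ (g * h)
  counit_compat : ∀ φ : B, W'.counit φ = pair φ 1
  antipode_compat : ∀ (φ : B) (h : A), pair (W'.antipode φ) h = pair φ (W.antipode h)

namespace WeakHopf

variable {k A}
variable (W : WeakHopf k A)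

lemma εt_def (h : A) : W.εt h = TensorProduct.lid k A
    (TensorProduct.map W.counit LinearMap.id (W.comul 1 * (h ⊗ₜ[k] (1 : A)))) := rfl

lemma εs_def (h : A) : W.εs h = TensorProduct.rid k A
    (TensorProduct.map LinearMap.id W.counit (((1 : A) ⊗ₜ[k] h) * W.comul 1)) := rfl

lemma coassoc_apply (h : A) :
    TensorProduct.map W.comul LinearMap.id (W.comul h)
      = (TensorProduct.assoc k A A A).symm
          (TensorProduct.map LinearMap.id W.comul (W.comul h)) :=
  LinearMap.congr_fun W.comul_coassoc h

lemma coassoc_apply' (h : A) :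
    TensorProduct.map LinearMap.id W.comul (W.comul h)
      = TensorProduct.assoc k A A A
          (TensorProduct.map W.comul LinearMap.id (W.comul h)) := by
  rw [coassoc_apply]; simp

/-- slice of the second leg by a functional -/
def slice (φ : A →ₗ[k] k) : A ⊗[k] A →ₗ[k] A :=
  (TensorProduct.rid k A).toLinearMap ∘ₗ TensorProduct.map LinearMap.id φ

/-- slice of the first leg by a functional -/
def sliceL {B : Type*} [AddCommGroup B] [Module k B] (φ : A →ₗ[k] k) : A ⊗[k] B →ₗ[k] B :=
  (TensorProduct.lid k B).toLinearMap ∘ₗ TensorProduct.map φ LinearMap.id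

def sliceR {B : Type*} [AddCommGroup B] [Module k B] (φ : A →ₗ[k] k) : B ⊗[k] A →ₗ[k] B :=
  (TensorProduct.rid k B).toLinearMap ∘ₗ TensorProduct.map LinearMap.id φ

@[simp] lemma slice_tmul (φ : A →ₗ[k] k) (a b : A) : slice φ (a ⊗ₜ[k] b) = φ b • a := by
  simp [slice]

@[simp] lemma sliceL_tmul {B : Type*} [AddCommGroup B] [Module k B]
    (φ : A →ₗ[k] k) (a : A) (b : B) : sliceL φ (a ⊗ₜ[k] b) = φ a • b := by
  simp [sliceL]

@[simp] lemma sliceR_tmul {B : Type*} [AddCommGroup B] [Module k B]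
    (φ : A →ₗ[k] k) (a : A) (b : B) : sliceR φ (b ⊗ₜ[k] a) = φ a • b := by
  simp [sliceR]

lemma εt_eq (h : A) : W.εt h = sliceL (W.counit ∘ₗ LinearMap.mulRight k h) (W.comul 1) := by
  rw [εt_def]
  generalize W.comul 1 = t
  induction t using TensorProduct.induction_on with
  | zero => simp
  | tmul a b => simp
  | add x y hx hy => simp only [add_mul, map_add, hx, hy]

lemma εs_eq (h : A) : W.εs h = sliceR (W.counit ∘ₗ LinearMap.mulLeft k h) (W.comul 1) := by
  rw [εs_def]
  generalize W.comul 1 = t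
  induction t using TensorProduct.induction_on with
  | zero => simp
  | tmul a b => simp
  | add x y hx hy => simp only [mul_add, map_add, hx, hy]

lemma counit_l (a : A) : sliceL W.counit (W.comul a) = a := W.counit_comul_left a
lemma counit_r (a : A) : sliceR W.counit (W.comul a) = a := W.counit_comul_right a

lemma sliceL_map (φ : A →ₗ[k] k) {B C : Type*} [AddCommGroup B] [Module k B]
    [AddCommGroup C] [Module k C] (f : B →ₗ[k] C) (t : A ⊗[k] B) :
    f (sliceL φ t) = sliceL φ (TensorProduct.map LinearMap.id f t) := by
  induction t using TensorProduct.induction_on with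
  | zero => simp
  | tmul a b => simp
  | add x y hx hy => simp only [map_add, hx, hy]

lemma sliceR_map (φ : A →ₗ[k] k) {B C : Type*} [AddCommGroup B] [Module k B]
    [AddCommGroup C] [Module k C] (f : B →ₗ[k] C) (t : B ⊗[k] A) :
    f (sliceR φ t) = sliceR φ (TensorProduct.map f LinearMap.id t) := by
  induction t using TensorProduct.induction_on with
  | zero => simp
  | tmul a b => simp
  | add x y hx hy => simp only [map_add, hx, hy]

lemma comul_εt (h : A) : W.comul (W.εt h) = (W.εt h ⊗ₜ[k] 1) * W.comul 1 := by
  rw [εt_eq, sliceL_map, coassoc_apply', W.comul_one_left]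
  generalize W.comul 1 = u
  generalize hφ : W.counit ∘ₗ LinearMap.mulRight k h = φ
  suffices H : ∀ t : A ⊗[k] A, sliceL φ (TensorProduct.assoc k A A A ((t ⊗ₜ[k] (1 : A)) *
      (TensorProduct.assoc k A A A).symm ((1 : A) ⊗ₜ[k] u))) = (sliceL φ t ⊗ₜ[k] 1) * u from H u
  intro t
  induction t using TensorProduct.induction_on with
  | zero => simp
  | add x y hx hy => simp only [TensorProduct.add_tmul, add_mul, map_add, hx, hy]
  | tmul a b =>
    induction u using TensorProduct.induction_on with
    | zero => simp
    | add x y hx hy => simp only [TensorProduct.tmul_add, mul_add, map_add, hx, hy]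
    | tmul c d => simp [TensorProduct.smul_tmul']

lemma comul_εt' (h : A) : W.comul (W.εt h) = W.comul 1 * (W.εt h ⊗ₜ[k] 1) := by
  rw [εt_eq, sliceL_map, coassoc_apply', W.comul_one_right]
  generalize W.comul 1 = u
  generalize hφ : W.counit ∘ₗ LinearMap.mulRight k h = φ
  suffices H : ∀ t : A ⊗[k] A, sliceL φ (TensorProduct.assoc k A A A (
      (TensorProduct.assoc k A A A).symm ((1 : A) ⊗ₜ[k] u) * (t ⊗ₜ[k] (1 : A)))) =
      u * (sliceL φ t ⊗ₜ[k] 1) from H u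
  intro t
  induction t using TensorProduct.induction_on with
  | zero => simp
  | add x y hx hy => simp only [TensorProduct.add_tmul, mul_add, map_add, hx, hy]
  | tmul a b =>
    induction u using TensorProduct.induction_on with
    | zero => simp
    | add x y hx hy => simp only [TensorProduct.tmul_add, add_mul, map_add, hx, hy]
    | tmul c d => simp [TensorProduct.smul_tmul']

lemma comul_εs (h : A) : W.comul (W.εs h) = (1 ⊗ₜ[k] W.εs h) * W.comul 1 := by
  rw [εs_eq, sliceR_map, W.comul_one_right]
  generalize hφ : W.counit ∘ₗ LinearMap.mulLeft k h = φ
  generalize W.comul 1 = t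
  suffices H : ∀ u : A ⊗[k] A, sliceR φ (
      (TensorProduct.assoc k A A A).symm ((1 : A) ⊗ₜ[k] u) * (t ⊗ₜ[k] (1 : A))) =
      (1 ⊗ₜ[k] sliceR φ u) * t from H t
  intro u
  induction u using TensorProduct.induction_on with
  | zero => simp
  | add x y hx hy => simp only [TensorProduct.tmul_add, add_mul, map_add, hx, hy]
  | tmul c d =>
    induction t using TensorProduct.induction_on with
    | zero => simp
    | add x y hx hy => simp only [TensorProduct.add_tmul, mul_add, map_add, hx, hy]
    | tmul a b => simp

lemma comul_εs' (h : A) : W.comul (W.εs h) = W.comul 1 * (1 ⊗ₜ[k] W.εs h) := by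
  rw [εs_eq, sliceR_map, W.comul_one_left]
  generalize hφ : W.counit ∘ₗ LinearMap.mulLeft k h = φ
  generalize W.comul 1 = t
  suffices H : ∀ u : A ⊗[k] A, sliceR φ ((t ⊗ₜ[k] (1 : A)) *
      (TensorProduct.assoc k A A A).symm ((1 : A) ⊗ₜ[k] u)) =
      t * (1 ⊗ₜ[k] sliceR φ u) from H t
  intro u
  induction u using TensorProduct.induction_on with
  | zero => simp
  | add x y hx hy => simp only [TensorProduct.tmul_add, mul_add, map_add, hx, hy]
  | tmul c d =>
    induction t using TensorProduct.induction_on with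
    | zero => simp
    | add x y hx hy => simp only [TensorProduct.add_tmul, add_mul, map_add, hx, hy]
    | tmul a b => simp

lemma εt_εs_comm (g h : A) : W.εt h * W.εs g = W.εs g * W.εt h := by
  have e := W.comul_one_left.symm.trans W.comul_one_right
  have e2 := congrArg (fun x => sliceL (W.counit ∘ₗ LinearMap.mulRight k h)
    (TensorProduct.map LinearMap.id (sliceR (W.counit ∘ₗ LinearMap.mulLeft k g))
      (TensorProduct.assoc k A A A x))) e
  rw [εt_eq, εs_eq]
  have H1 : ∀ (φ ψ : A →ₗ[k] k) (t u : A ⊗[k] A),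
      sliceL φ (TensorProduct.map LinearMap.id (sliceR ψ)
      (TensorProduct.assoc k A A A ((t ⊗ₜ[k] (1 : A)) *
      (TensorProduct.assoc k A A A).symm ((1 : A) ⊗ₜ[k] u)))) = sliceL φ t * sliceR ψ u := by
    intro φ ψ t u
    induction t using TensorProduct.induction_on with
    | zero => simp
    | add x y hx hy => simp only [TensorProduct.add_tmul, add_mul, map_add, hx, hy]
    | tmul a b =>
      induction u using TensorProduct.induction_on with
      | zero => simp
      | add x y hx hy => simp only [TensorProduct.tmul_add, mul_add, map_add, hx, hy]
      | tmul c d => simp [smul_smul, mul_comm]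
  have H2 : ∀ (φ ψ : A →ₗ[k] k) (t u : A ⊗[k] A),
      sliceL φ (TensorProduct.map LinearMap.id (sliceR ψ)
      (TensorProduct.assoc k A A A (
      (TensorProduct.assoc k A A A).symm ((1 : A) ⊗ₜ[k] u) * (t ⊗ₜ[k] (1 : A))))) =
      sliceR ψ u * sliceL φ t := by
    intro φ ψ t u
    induction t using TensorProduct.induction_on with
    | zero => simp
    | add x y hx hy => simp only [TensorProduct.add_tmul, mul_add, map_add, hx, hy]
    | tmul a b =>
      induction u using TensorProduct.induction_on with
      | zero => simp
      | add x y hx hy => simp only [TensorProduct.tmul_add, add_mul, map_add, hx, hy]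
      | tmul c d => simp [smul_smul, mul_comm]
  rw [H1, H2] at e2
  exact e2

/-- `ε_s(h₁) ⊗ h₂ = 1₁ ⊗ h 1₂` -/
lemma map_εs_comul (h : A) :
    TensorProduct.map W.εs LinearMap.id (W.comul h) = (1 ⊗ₜ[k] h) * W.comul 1 := by
  have P : ∀ t : A ⊗[k] A, ((1 : A) ⊗ₜ[k] h) * t =
      TensorProduct.map LinearMap.id (sliceL W.counit ∘ₗ LinearMap.mulLeft k (W.comul h))
        (TensorProduct.map LinearMap.id W.comul t) := by
    intro t
    induction t using TensorProduct.induction_on with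
    | zero => simp
    | add x y hx hy => simp only [mul_add, map_add, hx, hy]
    | tmul a b => simp [← W.comul_mul, counit_l]
  have Q : ∀ X t u : A ⊗[k] A,
      TensorProduct.map LinearMap.id (sliceL W.counit ∘ₗ LinearMap.mulLeft k X)
      (TensorProduct.assoc k A A A (
      (TensorProduct.assoc k A A A).symm ((1 : A) ⊗ₜ[k] u) * (t ⊗ₜ[k] (1 : A)))) =
      TensorProduct.map LinearMap.id (sliceL W.counit ∘ₗ LinearMap.mulLeft k (X * u)
        ∘ₗ (TensorProduct.mk k A A).flip 1) t := by
    intro X t u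
    induction t using TensorProduct.induction_on with
    | zero => simp
    | add x y hx hy => simp only [TensorProduct.add_tmul, mul_add, map_add, hx, hy]
    | tmul a b =>
      simp only [TensorProduct.map_tmul, LinearMap.comp_apply, LinearMap.mulLeft_apply]
      induction u using TensorProduct.induction_on with
      | zero => simp
      | add x y hx hy => simp only [TensorProduct.tmul_add, add_mul, mul_add, map_add, hx, hy]
      | tmul c d => simp [mul_assoc]
  rw [P, coassoc_apply', W.comul_one_right, Q, ← W.comul_mul, mul_one]
  generalize W.comul h = X
  have R : ∀ t : A ⊗[k] A, ∀ p q : A, TensorProduct.map LinearMap.id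
      (sliceL W.counit ∘ₗ LinearMap.mulLeft k (p ⊗ₜ[k] q) ∘ₗ (TensorProduct.mk k A A).flip 1) t
      = (sliceR (W.counit ∘ₗ LinearMap.mulLeft k p) t) ⊗ₜ[k] q := by
    intro t p q
    induction t using TensorProduct.induction_on with
    | zero => simp
    | add x y hx hy => simp only [TensorProduct.add_tmul, map_add, hx, hy]
    | tmul a b => simp [TensorProduct.smul_tmul]
  have hadd : ∀ x y t : A ⊗[k] A, TensorProduct.map (LinearMap.id : A →ₗ[k] A)
      (sliceL W.counit ∘ₗ LinearMap.mulLeft k (x + y) ∘ₗ (TensorProduct.mk k A A).flip 1) t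
      = TensorProduct.map LinearMap.id
      (sliceL W.counit ∘ₗ LinearMap.mulLeft k x ∘ₗ (TensorProduct.mk k A A).flip 1) t +
      TensorProduct.map LinearMap.id
      (sliceL W.counit ∘ₗ LinearMap.mulLeft k y ∘ₗ (TensorProduct.mk k A A).flip 1) t := by
    intro x y t
    induction t using TensorProduct.induction_on with
    | zero => simp
    | add x y hx hy => simp only [map_add, hx, hy]; abel
    | tmul a b => simp [TensorProduct.tmul_add, add_mul]
  induction X using TensorProduct.induction_on with
  | zero =>
    rw [map_zero]
    generalize W.comul 1 = t
    induction t using TensorProduct.induction_on with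
    | zero => simp
    | add x y hx hy => simp only [map_add, ← hx, ← hy]; simp
    | tmul a b => simp
  | add x y hx hy => rw [hadd, map_add, hx, hy]
  | tmul p q => rw [R, ← εs_eq]; simp

/-- `h₁ ⊗ ε_t(h₂) = 1₁ h ⊗ 1₂` -/
lemma map_εt_comul (h : A) :
    TensorProduct.map LinearMap.id W.εt (W.comul h) = W.comul 1 * (h ⊗ₜ[k] 1) := by
  have P : ∀ t : A ⊗[k] A, t * (h ⊗ₜ[k] (1 : A)) =
      TensorProduct.map (sliceR W.counit ∘ₗ LinearMap.mulRight k (W.comul h)) LinearMap.id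
        (TensorProduct.map W.comul LinearMap.id t) := by
    intro t
    induction t using TensorProduct.induction_on with
    | zero => simp
    | add x y hx hy => simp only [add_mul, map_add, hx, hy]
    | tmul a b => simp [← W.comul_mul, counit_r]
  have Q : ∀ X t u : A ⊗[k] A,
      TensorProduct.map (sliceR W.counit ∘ₗ LinearMap.mulRight k X) LinearMap.id (
      (TensorProduct.assoc k A A A).symm ((1 : A) ⊗ₜ[k] u) * (t ⊗ₜ[k] (1 : A))) =
      TensorProduct.map (sliceR W.counit ∘ₗ LinearMap.mulRight k (t * X)
        ∘ₗ (TensorProduct.mk k A A 1)) LinearMap.id u := by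
    intro X t u
    induction u using TensorProduct.induction_on with
    | zero => simp
    | add x y hx hy => simp only [TensorProduct.tmul_add, add_mul, map_add, hx, hy]
    | tmul a b =>
      simp only [TensorProduct.map_tmul, LinearMap.comp_apply, LinearMap.mulRight_apply]
      induction t using TensorProduct.induction_on with
      | zero => simp
      | add x y hx hy => simp only [TensorProduct.add_tmul, add_mul, mul_add, map_add, hx, hy]
      | tmul c d => simp [← mul_assoc]
  rw [P, W.comul_one_right, Q, ← W.comul_mul, one_mul]
  generalize W.comul h = X
  have R : ∀ t : A ⊗[k] A, ∀ p q : A, TensorProduct.map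
      (sliceR W.counit ∘ₗ LinearMap.mulRight k (p ⊗ₜ[k] q) ∘ₗ (TensorProduct.mk k A A 1))
      LinearMap.id t
      = p ⊗ₜ[k] (sliceL (W.counit ∘ₗ LinearMap.mulRight k q) t) := by
    intro t p q
    induction t using TensorProduct.induction_on with
    | zero => simp
    | add x y hx hy => simp only [TensorProduct.tmul_add, map_add, hx, hy]
    | tmul a b => simp [TensorProduct.smul_tmul]
  have hadd : ∀ x y t : A ⊗[k] A, TensorProduct.map
      (sliceR W.counit ∘ₗ LinearMap.mulRight k (x + y) ∘ₗ (TensorProduct.mk k A A 1))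
      (LinearMap.id : A →ₗ[k] A) t
      = TensorProduct.map
      (sliceR W.counit ∘ₗ LinearMap.mulRight k x ∘ₗ (TensorProduct.mk k A A 1)) LinearMap.id t +
      TensorProduct.map
      (sliceR W.counit ∘ₗ LinearMap.mulRight k y ∘ₗ (TensorProduct.mk k A A 1))
      LinearMap.id t := by
    intro x y t
    induction t using TensorProduct.induction_on with
    | zero => simp
    | add x y hx hy => simp only [map_add, hx, hy]; abel
    | tmul a b => simp [TensorProduct.add_tmul, mul_add]
  induction X using TensorProduct.induction_on with
  | zero =>
    rw [map_zero]
    generalize W.comul 1 = t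
    induction t using TensorProduct.induction_on with
    | zero => simp
    | add x y hx hy => simp only [map_add, ← hx, ← hy]; simp
    | tmul a b => simp
  | add x y hx hy => rw [hadd, map_add, hx, hy]
  | tmul p q => rw [R, ← εt_eq]; simp

lemma counit_mul_εs (g x : A) : W.counit (g * x) = W.counit (W.εs g * x) := by
  have := W.counit_mul_right g 1 x
  rw [mul_one] at this
  rw [this, εs_eq]
  generalize W.comul 1 = t
  induction t using TensorProduct.induction_on with
  | zero => simp
  | add x y hx hy => simp only [map_add, add_mul, hx, hy]
  | tmul a b => simp [mul_comm]

lemma εs_mul (g x : A) : W.εs (g * x) = W.εs (W.εs g * x) := by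
  rw [εs_eq, εs_eq (h := W.εs g * x)]
  congr 2
  ext y
  simp [mul_assoc, W.counit_mul_εs g]

lemma εs_mul_comul (g x : A) : W.εs (g * x) =
    sliceL (W.counit ∘ₗ LinearMap.mulLeft k g) (TensorProduct.map LinearMap.id W.εs (W.comul x)) := by
  rw [εs_eq]
  have : W.counit ∘ₗ LinearMap.mulLeft k (g * x) = sliceL (W.counit ∘ₗ LinearMap.mulLeft k g)
      (TensorProduct.map LinearMap.id (LinearMap.llcomp k A A k W.counit ∘ₗ LinearMap.mul k A)
        (W.comul x)) := by
    ext y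
    simp only [LinearMap.comp_apply, LinearMap.mulLeft_apply]
    rw [W.counit_mul_left]
    generalize W.comul x = t
    induction t using TensorProduct.induction_on with
    | zero => simp
    | add x y hx hy => simp only [map_add, LinearMap.add_apply, hx, hy]
    | tmul a b => simp
  rw [this]
  generalize W.comul x = t
  induction t using TensorProduct.induction_on with
  | zero => simp [sliceR]
  | add x y hx hy =>
    simp only [map_add, ← hx, ← hy]
    simp [sliceR, TensorProduct.map_add_right]
  | tmul a b =>
    simp [εs_eq, sliceR, TensorProduct.map_smul_right]
    congr 2

/-- `h₁ ⊗ ε_s(h₂) = h 1₁ ⊗ ε_s(1₂)` -/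
lemma map_id_εs_comul (h : A) : TensorProduct.map LinearMap.id W.εs (W.comul h) =
    (h ⊗ₜ[k] 1) * TensorProduct.map LinearMap.id W.εs (W.comul 1) := by
  have P : ∀ (p q : A) (Y : A ⊗[k] A), TensorProduct.map LinearMap.id W.εs ((p ⊗ₜ[k] q) * Y) =
      TensorProduct.map (sliceR W.counit ∘ₗ LinearMap.mulLeft k (p ⊗ₜ[k] q)) W.εs
       ((TensorProduct.assoc k A A A).symm (TensorProduct.map LinearMap.id W.comul Y)) := by
    intro p q Y
    induction Y using TensorProduct.induction_on with
    | zero => simp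
    | add x y hx hy => simp only [map_add, mul_add, hx, hy]
    | tmul a b =>
      simp [εs_mul_comul]
      generalize W.comul b = t
      induction t using TensorProduct.induction_on with
      | zero => simp
      | add x y hx hy => simp only [map_add, TensorProduct.tmul_add, hx, hy]
      | tmul a b => simp [TensorProduct.smul_tmul]
  have R : ∀ X Y : A ⊗[k] A, TensorProduct.map LinearMap.id W.εs (X * Y) =
      TensorProduct.lift ((TensorProduct.mk k A A).compl₁₂ (LinearMap.id) W.εs)
       (TensorProduct.map (sliceR W.counit ∘ₗ LinearMap.mulLeft k X) LinearMap.id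
       ((TensorProduct.assoc k A A A).symm (TensorProduct.map LinearMap.id W.comul Y))) := by
    intro X Y
    induction X using TensorProduct.induction_on with
    | zero =>
      have : LinearMap.mulLeft k (0 : A ⊗[k] A) = 0 := by ext; simp
      simp [this]
    | add x y hx hy =>
      have : LinearMap.mulLeft k (x + y) = LinearMap.mulLeft k x + LinearMap.mulLeft k y := by
        ext <;> simp [add_mul]
      rw [add_mul, map_add, hx, hy, this]
      simp [LinearMap.comp_add, TensorProduct.map_add_left]
    | tmul p q =>
      rw [P]
      generalize (TensorProduct.assoc k A A A).symm _ = Z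
      induction Z using TensorProduct.induction_on with
      | zero => simp
      | add x y hx hy => simp only [map_add, hx, hy]
      | tmul a b => simp
  conv_lhs => rw [← mul_one h, W.comul_mul]
  rw [R, ← coassoc_apply]
  generalize W.comul 1 = t
  induction t using TensorProduct.induction_on with
  | zero => simp
  | add x y hx hy => simp only [map_add, mul_add, hx, hy]
  | tmul a b => simp [← W.comul_mul, counit_r]

lemma εt_antipode (h : A) : LinearMap.mul' k A (TensorProduct.map LinearMap.id W.antipode (W.comul h))
    = W.εt h := W.antipode_left h

lemma εs_antipode (h : A) : LinearMap.mul' k A (TensorProduct.map W.antipode LinearMap.id (W.comul h))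
    = W.εs h := W.antipode_right h

lemma εs_mul_antipode (h : A) :
    LinearMap.mul' k A (TensorProduct.map W.εs W.antipode (W.comul h)) = W.antipode h := by
  rw [← W.antipode_mid h]
  generalize W.comul h = t
  induction t using TensorProduct.induction_on with
  | zero => simp
  | add x y hx hy => simp only [map_add, hx, hy]
  | tmul a b => simp [← εs_antipode]

lemma antipode_mul_εt (h : A) :
    LinearMap.mul' k A (TensorProduct.map W.antipode W.εt (W.comul h)) = W.antipode h := by
  rw [← W.antipode_mid h, coassoc_apply]
  generalize W.comul h = t
  induction t using TensorProduct.induction_on with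
  | zero => simp
  | add x y hx hy => simp only [map_add, hx, hy]
  | tmul a b =>
    simp only [TensorProduct.map_tmul, ← εt_antipode, LinearMap.id_apply]
    generalize W.comul b = u
    induction u using TensorProduct.induction_on with
    | zero => simp
    | add x y hx hy =>
      simp only [map_add, TensorProduct.tmul_add, ← hx, ← hy]
    | tmul c d => simp [mul_assoc]

lemma left_integral_comul {l : A} (hl : W.IsLeftIntegral l) (h : A) :
    (1 ⊗ₜ[k] h) * W.comul l = (W.antipode h ⊗ₜ[k] 1) * W.comul l := by
  -- the common value is `S(h₁) h₂ l₁ ⊗ h₃ l₂`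
  have e1 : (1 ⊗ₜ[k] h) * W.comul l =
      (TensorProduct.map W.εs LinearMap.id (W.comul h)) * W.comul l := by
    rw [map_εs_comul, mul_assoc, ← W.comul_mul, one_mul]
  have e2 : ∀ t : A ⊗[k] A, TensorProduct.map W.εs LinearMap.id t =
      TensorProduct.map (LinearMap.mul' k A ∘ₗ TensorProduct.map W.antipode LinearMap.id)
        LinearMap.id (TensorProduct.map W.comul LinearMap.id t) := by
    intro t
    induction t using TensorProduct.induction_on with
    | zero => simp
    | add x y hx hy => simp only [map_add, hx, hy]
    | tmul a b => simp [← εs_antipode]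
  have e3 : ∀ t : A ⊗[k] A,
      TensorProduct.map (LinearMap.mul' k A ∘ₗ TensorProduct.map W.antipode LinearMap.id)
        LinearMap.id ((TensorProduct.assoc k A A A).symm (TensorProduct.map LinearMap.id W.comul t))
        * W.comul l =
      (LinearMap.mul' k A (TensorProduct.map W.antipode W.εt t) ⊗ₜ[k] 1) * W.comul l := by
    intro t
    induction t using TensorProduct.induction_on with
    | zero => simp
    | add x y hx hy => simp only [map_add, add_mul, TensorProduct.add_tmul, hx, hy]
    | tmul a b =>
      have key : (W.εt b ⊗ₜ[k] 1) * W.comul l = W.comul b * W.comul l := by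
        rw [← W.comul_mul, hl b, W.comul_mul, comul_εt, mul_assoc, ← W.comul_mul, one_mul]
      have key2 : ∀ u : A ⊗[k] A, TensorProduct.map
          (LinearMap.mul' k A ∘ₗ TensorProduct.map W.antipode LinearMap.id)
          LinearMap.id ((TensorProduct.assoc k A A A).symm (a ⊗ₜ[k] u))
          = (W.antipode a ⊗ₜ[k] 1) * u := by
        intro u
        induction u using TensorProduct.induction_on with
        | zero => simp
        | add x y hx hy => simp only [map_add, mul_add, TensorProduct.tmul_add, hx, hy]
        | tmul c d => simp
      simp only [TensorProduct.map_tmul, LinearMap.id_apply, LinearMap.mul'_apply]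
      rw [key2, mul_assoc, ← key, ← mul_assoc]
      simp
  rw [e1, e2, coassoc_apply, e3, antipode_mul_εt]

lemma right_integral_comul {l : A} (hl : W.IsRightIntegral l) (h : A) :
    W.comul l * (h ⊗ₜ[k] 1) = W.comul l * (1 ⊗ₜ[k] W.antipode h) := by
  have e1 : W.comul l * (h ⊗ₜ[k] 1) =
      W.comul l * (TensorProduct.map LinearMap.id W.εt (W.comul h)) := by
    rw [map_εt_comul, ← mul_assoc, ← W.comul_mul, mul_one]
  have e2 : ∀ t : A ⊗[k] A, TensorProduct.map LinearMap.id W.εt t =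
      TensorProduct.map LinearMap.id
        (LinearMap.mul' k A ∘ₗ TensorProduct.map LinearMap.id W.antipode)
        (TensorProduct.map LinearMap.id W.comul t) := by
    intro t
    induction t using TensorProduct.induction_on with
    | zero => simp
    | add x y hx hy => simp only [map_add, hx, hy]
    | tmul a b => simp [← εt_antipode]
  have e3 : ∀ t : A ⊗[k] A,
      W.comul l * TensorProduct.map LinearMap.id
        (LinearMap.mul' k A ∘ₗ TensorProduct.map LinearMap.id W.antipode)
        ((TensorProduct.assoc k A A A) (TensorProduct.map W.comul LinearMap.id t)) =
      W.comul l * (1 ⊗ₜ[k] LinearMap.mul' k A (TensorProduct.map W.εs W.antipode t)) := by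
    intro t
    induction t using TensorProduct.induction_on with
    | zero => simp
    | add x y hx hy => simp only [map_add, mul_add, TensorProduct.tmul_add, hx, hy]
    | tmul a b =>
      have key : W.comul l * (1 ⊗ₜ[k] W.εs a) = W.comul l * W.comul a := by
        rw [← W.comul_mul, hl a, W.comul_mul, comul_εs', ← mul_assoc, ← W.comul_mul, mul_one]
      have key2 : ∀ u : A ⊗[k] A, TensorProduct.map LinearMap.id
          (LinearMap.mul' k A ∘ₗ TensorProduct.map LinearMap.id W.antipode)
          ((TensorProduct.assoc k A A A) (u ⊗ₜ[k] b))
          = u * (1 ⊗ₜ[k] W.antipode b) := by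
        intro u
        induction u using TensorProduct.induction_on with
        | zero => simp
        | add x y hx hy => simp only [map_add, add_mul, TensorProduct.add_tmul, hx, hy]
        | tmul c d => simp
      simp only [TensorProduct.map_tmul, LinearMap.id_apply, LinearMap.mul'_apply]
      rw [key2, ← mul_assoc, ← key, mul_assoc]
      simp
  rw [e1, e2, coassoc_apply', e3, εs_mul_antipode]

lemma slice_mul_left (φ : A →ₗ[k] k) (a : A) (X : A ⊗[k] A) :
    slice φ ((a ⊗ₜ[k] 1) * X) = a * slice φ X := by
  induction X using TensorProduct.induction_on with
  | zero => simp
  | add x y hx hy => simp only [map_add, mul_add, hx, hy]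
  | tmul c d => simp

lemma slice_mul_right (φ : A →ₗ[k] k) (a : A) (X : A ⊗[k] A) :
    slice φ (X * (a ⊗ₜ[k] 1)) = slice φ X * a := by
  induction X using TensorProduct.induction_on with
  | zero => simp
  | add x y hx hy => simp only [map_add, add_mul, hx, hy]
  | tmul c d => simp

lemma εt_one : W.εt 1 = 1 := by
  rw [εt_def]
  have : ((1 : A) ⊗ₜ[k] (1 : A)) = 1 := rfl
  rw [this, mul_one, W.counit_comul_left]

lemma εs_one : W.εs 1 = 1 := by
  rw [εs_def]
  have : ((1 : A) ⊗ₜ[k] (1 : A)) = 1 := rfl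
  rw [this, one_mul, W.counit_comul_right]

lemma antipode_eq {l : A} (hl : W.IsLeftIntegral l) {lam : A →ₗ[k] k} (hlam : slice lam (W.comul l) = 1)
    (h : A) : W.antipode h = slice lam ((1 ⊗ₜ[k] h) * W.comul l) := by
  rw [left_integral_comul W hl, slice_mul_left, hlam, mul_one]

lemma antipode_mul {l : A} (hl : W.IsLeftIntegral l) {lam : A →ₗ[k] k} (hlam : slice lam (W.comul l) = 1)
    (g h : A) : W.antipode (g * h) = W.antipode h * W.antipode g := by
  have e : ((1 : A) ⊗ₜ[k] (g * h)) = (1 ⊗ₜ[k] g) * (1 ⊗ₜ[k] h) := by simp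
  have e2 : ((1 : A) ⊗ₜ[k] g) * (W.antipode h ⊗ₜ[k] 1) =
    (W.antipode h ⊗ₜ[k] 1) * ((1 : A) ⊗ₜ[k] g) := by simp
  rw [antipode_eq W hl hlam (g * h), e, mul_assoc, left_integral_comul W hl h, ← mul_assoc, e2,
    mul_assoc, slice_mul_left, ← antipode_eq W hl hlam]

lemma εt_source {l : A} (hl : W.IsLeftIntegral l) {lam : A →ₗ[k] k} (hlam : slice lam (W.comul l) = 1)
    (y : A) : W.εt (W.εs y) = W.antipode (W.εs y) := by
  rw [← εt_antipode, comul_εs]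
  have : ∀ t : A ⊗[k] A, LinearMap.mul' k A (TensorProduct.map LinearMap.id W.antipode
      ((1 ⊗ₜ[k] W.εs y) * t)) = LinearMap.mul' k A (TensorProduct.map LinearMap.id W.antipode t) *
        W.antipode (W.εs y) := by
    intro X
    induction X using TensorProduct.induction_on with
    | zero => simp
    | add x y hx hy => simp only [map_add, add_mul, mul_add, hx, hy]
    | tmul c d => simp [antipode_mul W hl hlam, mul_assoc]
  rw [this, εt_antipode, εt_one, one_mul]

lemma εs_target {l : A} (hl : W.IsLeftIntegral l) {lam : A →ₗ[k] k} (hlam : slice lam (W.comul l) = 1)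
    (y : A) : W.εs (W.εt y) = W.antipode (W.εt y) := by
  rw [← εs_antipode, comul_εt']
  have : ∀ t : A ⊗[k] A, LinearMap.mul' k A (TensorProduct.map W.antipode LinearMap.id
      (t * (W.εt y ⊗ₜ[k] 1))) = W.antipode (W.εt y) *
        LinearMap.mul' k A (TensorProduct.map W.antipode LinearMap.id t) := by
    intro X
    induction X using TensorProduct.induction_on with
    | zero => simp
    | add x y hx hy => simp only [map_add, add_mul, mul_add, hx, hy]
    | tmul c d => simp [antipode_mul W hl hlam, mul_assoc]
  rw [this, εs_antipode, εs_one, mul_one]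

lemma εs_S (h : A) : W.εs (W.antipode h) = W.εs (W.εt h) := by
  rw [← εt_antipode, ← εs_mul_antipode]
  generalize W.comul h = t
  induction t using TensorProduct.induction_on with
  | zero => simp
  | add x y hx hy => simp only [map_add, hx, hy]
  | tmul c d => simp [W.εs_mul c]

lemma right_of_left {l : A} (hl : W.IsLeftIntegral l) {lam : A →ₗ[k] k} (hlam : slice lam (W.comul l) = 1)
    {r : A} (hr : W.IsLeftIntegral r) : W.IsRightIntegral (W.antipode r) := by
  intro g
  obtain ⟨h, rfl⟩ := W.antipode_bijective.2 g
  rw [εs_S, εs_target W hl hlam, ← antipode_mul W hl hlam, hr h, antipode_mul W hl hlam]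

lemma antipode_right_integral {l : A} (hl : W.IsLeftIntegral l) {lam : A →ₗ[k] k} (hlam : slice lam (W.comul l) = 1)
    {r : A} (hr : W.IsRightIntegral r) :
    W.antipode r = l * W.εs (slice lam (W.comul r)) := by
  have e1 : ∀ X : A ⊗[k] A, ((1 : A) ⊗ₜ[k] r) * X =
      (1 ⊗ₜ[k] r) * TensorProduct.map LinearMap.id W.εs X := by
    intro X
    induction X using TensorProduct.induction_on with
    | zero => simp
    | add x y hx hy => simp only [map_add, mul_add, hx, hy]
    | tmul c d => simp [hr d]
  have e2 : ((1 : A) ⊗ₜ[k] r) * (l ⊗ₜ[k] 1) = (l ⊗ₜ[k] 1) * ((1 : A) ⊗ₜ[k] r) := by simp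
  rw [antipode_eq W hl hlam, e1, map_id_εs_comul, ← mul_assoc, e2, mul_assoc, slice_mul_left,
    ← e1, ← map_εs_comul]
  congr 1
  generalize W.comul r = X
  induction X using TensorProduct.induction_on with
  | zero => simp
  | add x y hx hy => simp only [map_add, hx, hy]
  | tmul c d => simp

end WeakHopf

/-- For a finite-dimensional regular unimodular weak Hopf algebra `A`
(with non-degenerate two-sided integral `ℓ₀`), the map `z ↦ ℓ₀z` is a bijection from
`A_t ∩ Z(A)` onto the space of `S`-invariant left integrals; consequently, if `A` is
connected then `A` has a non-degenerate `S`-invariant left integral, unique up to scalar. -/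
theorem stmt_0 {k A : Type*} [Field k] [IsAlgClosed k] [CharZero k]
    [Ring A] [Algebra k A] [FiniteDimensional k A]
    (W : WeakHopf k A) (hreg : W.Regular)
    (ℓ₀ : A) (hleft : W.IsLeftIntegral ℓ₀) (hright : W.IsRightIntegral ℓ₀)
    (hnd : W.IsNondegenerateIntegral ℓ₀) :
    (∀ z₁ z₂ : A,
        (z₁ ∈ W.targetBase ∧ z₁ ∈ Subalgebra.center k A) →
        (z₂ ∈ W.targetBase ∧ z₂ ∈ Subalgebra.center k A) →
        ℓ₀ * z₁ = ℓ₀ * z₂ → z₁ = z₂) ∧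
    (∀ z : A, (z ∈ W.targetBase ∧ z ∈ Subalgebra.center k A) →
        W.IsLeftIntegral (ℓ₀ * z) ∧ W.antipode (ℓ₀ * z) = ℓ₀ * z) ∧
    (∀ ℓ : A, W.IsLeftIntegral ℓ → W.antipode ℓ = ℓ →
        ∃ z : A, (z ∈ W.targetBase ∧ z ∈ Subalgebra.center k A) ∧ ℓ = ℓ₀ * z) ∧
    (W.Connected →
      ∃ ℓ : A, W.IsLeftIntegral ℓ ∧ W.antipode ℓ = ℓ ∧ W.IsNondegenerateIntegral ℓ ∧
        ∀ ℓ' : A, W.IsLeftIntegral ℓ' → W.antipode ℓ' = ℓ' →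
          W.IsNondegenerateIntegral ℓ' → ∃ c : k, ℓ' = c • ℓ) := by

  obtain ⟨lam, hlam⟩ : ∃ lam : A →ₗ[k] k, WeakHopf.slice lam (W.comul ℓ₀) = 1 := by
    let T : Module.Dual k A →ₗ[k] A :=
      { toFun := fun φ => W.harpoon φ ℓ₀
        map_add' := by
          intro φ ψ
          simp [WeakHopf.harpoon, TensorProduct.map_add_right]
        map_smul' := by
          intro c φ
          simp [WeakHopf.harpoon, TensorProduct.map_smul_right] }
    have hT : Function.Surjective T :=
      (LinearMap.injective_iff_surjective_of_finrank_eq_finrank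
        (Subspace.dual_finrank_eq)).1 hnd
    exact hT 1
  have hmul := W.antipode_mul hleft hlam
  have hS0 : W.antipode ℓ₀ = ℓ₀ := by
    rw [W.antipode_right_integral hleft hlam hright, hlam, W.εs_one, mul_one]
  have hdz : ∀ z ∈ W.targetBase, W.comul (ℓ₀ * z) = W.comul ℓ₀ * (z ⊗ₜ[k] 1) := by
    rintro _ ⟨x, rfl⟩
    rw [W.comul_mul, W.comul_εt', ← mul_assoc, ← W.comul_mul, mul_one]
  have hinj : ∀ z ∈ W.targetBase, WeakHopf.slice lam (W.comul (ℓ₀ * z)) = z := by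
    intro z hz
    rw [hdz z hz, WeakHopf.slice_mul_right, hlam, one_mul]
  have h3 : ∀ ℓ : A, W.IsLeftIntegral ℓ → W.antipode ℓ = ℓ →
        ∃ z : A, (z ∈ W.targetBase ∧ z ∈ Subalgebra.center k A) ∧ ℓ = ℓ₀ * z := by
    intro l hl hSl
    have hr : W.IsRightIntegral l := hSl ▸ W.right_of_left hleft hlam hl
    have e := W.antipode_right_integral hleft hlam hr
    rw [hSl] at e
    generalize WeakHopf.slice lam (W.comul l) = y at e
    have hz : W.antipode (W.εs y) ∈ W.targetBase := ⟨_, W.εt_source hleft hlam y⟩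
    have hSS : W.antipode (W.antipode (W.εs y)) = W.εs y :=
      hreg _ (Algebra.subset_adjoin (Or.inr ⟨y, rfl⟩))
    have ez : l = ℓ₀ * W.antipode (W.εs y) := by
      rw [hright, ← W.εt_source hleft hlam, W.εs_target hleft hlam, W.εt_source hleft hlam, hSS]
      exact e
    refine ⟨_, ⟨hz, ?_⟩, ez⟩
    generalize W.antipode (W.εs y) = z at hz ez
    rw [Subalgebra.mem_center_iff]
    intro h
    have c := congrArg (WeakHopf.slice lam) (W.right_integral_comul hr h)
    have e2 : (z ⊗ₜ[k] (1 : A)) * ((1 : A) ⊗ₜ[k] W.antipode h) =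
      ((1 : A) ⊗ₜ[k] W.antipode h) * (z ⊗ₜ[k] (1 : A)) := by simp
    rw [ez, hdz z hz, mul_assoc (W.comul ℓ₀) _ (1 ⊗ₜ[k] W.antipode h), e2, ← mul_assoc,
      ← W.right_integral_comul hright] at c
    simp only [WeakHopf.slice_mul_right, hlam, one_mul] at c
    exact c.symm
  refine ⟨?_, ?_, h3, ?_⟩
  · rintro z₁ z₂ ⟨h1, -⟩ ⟨h2, -⟩ h
    rw [← hinj z₁ h1, h, hinj z₂ h2]
  · rintro z ⟨hz, hc⟩
    refine ⟨fun h => by rw [← mul_assoc, hleft h, mul_assoc], ?_⟩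
    rw [Subalgebra.mem_center_iff] at hc
    obtain ⟨x, rfl⟩ := hz
    conv_lhs => rw [hc, hmul, hS0]
    rw [← W.εs_target hleft hlam, ← hright]
  · intro hcon
    refine ⟨ℓ₀, hleft, hS0, hnd, fun l hl hSl _ => ?_⟩
    obtain ⟨z, ⟨hz, hc⟩, rfl⟩ := h3 l hl hSl
    obtain ⟨c, rfl⟩ := (hcon z).1 ⟨hc, hz⟩
    exact ⟨c, by simp⟩
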